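/- Let d ≥ 1 and let σ : ℝ^d → ℝ^{d×d} be continuously differentiable such that: (a) σ(y) is a symmetric positive definite matrix for every y ∈ ℝ^d; (b) σ is globally Lipschitz, i.e., there exists D > 0 with ‖σ(x) − σ(y)‖ ≤ D‖x − y‖ for all x, y ∈ ℝ^d (operator norm); and (c) σ satisfies the curl condition. Then there exists a bijective, continuously differentiable map g : ℝ^d → ℝ^d whose Jacobian matrix satisfies Dg(y) = σ(y)^{-1} for every y ∈ ℝ^d. -/

import Mathlib

open Matrix

/-- The entrywise partial derivative of a matrix field `σ : ℝ^d → ℝ^{d×d}`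
at `y` in the coordinate direction `e_k` (here `ℝ^d` carries the Euclidean norm). -/
noncomputable def matPartialDeriv {d : ℕ}
    (σ : EuclideanSpace ℝ (Fin d) → Matrix (Fin d) (Fin d) ℝ)
    (y : EuclideanSpace ℝ (Fin d)) (k : Fin d) : Matrix (Fin d) (Fin d) ℝ :=
  Matrix.of fun i l => fderiv ℝ (fun y => σ y i l) y (EuclideanSpace.single k 1)

/-- The curl condition: for all `y`, `j`, `k`,
`(∂σ/∂y_k)(y) · σ(y)⁻¹ · e_j = (∂σ/∂y_j)(y) · σ(y)⁻¹ · e_k`. -/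
def CurlCondition {d : ℕ}
    (σ : EuclideanSpace ℝ (Fin d) → Matrix (Fin d) (Fin d) ℝ) : Prop :=
  ∀ (y : EuclideanSpace ℝ (Fin d)) (j k : Fin d),
    (matPartialDeriv σ y k * (σ y)⁻¹) *ᵥ Pi.single j 1
      = (matPartialDeriv σ y j * (σ y)⁻¹) *ᵥ Pi.single k 1

section Bijectivity

open scoped RealInnerProductSpace

variable {E : Type*} [NormedAddCommGroup E] [InnerProductSpace ℝ E]

theorem ContinuousLinearMap.sq_norm_div_le_inner_of_mul_eq_one {S T : E →L[ℝ] E}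
    (hT : (T : E →ₗ[ℝ] E).IsSymmetric) (hTS : T * S = 1) (hTpos : ∀ v, 0 ≤ ⟪T v, v⟫) {c : ℝ}
    (hc : 0 < c) (hS : ‖S‖ ≤ c) (v : E) : ‖v‖ ^ 2 / c ≤ ⟪T v, v⟫ := by
  have hTSv : T (S v) = v := DFunLike.congr_fun hTS v
  have hsymm : ⟪T v, S v⟫ = ‖v‖ ^ 2 := by
    have h : ⟪T v, S v⟫ = ⟪v, T (S v)⟫ := hT v (S v)
    rw [h, hTSv, real_inner_self_eq_norm_sq]
  have hbound : ⟪v, S v⟫ ≤ c * ‖v‖ ^ 2 := calc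
    ⟪v, S v⟫ ≤ ‖v‖ * ‖S v‖ := real_inner_le_norm _ _
    _ ≤ ‖v‖ * (c * ‖v‖) := by gcongr; exact S.le_of_opNorm_le hS v
    _ = c * ‖v‖ ^ 2 := by ring
  have h := hTpos (v - c⁻¹ • S v)
  simp only [map_sub, map_smul, hTSv, inner_sub_left, inner_sub_right, inner_smul_left,
    inner_smul_right, hsymm, real_inner_self_eq_norm_sq, conj_trivial] at h
  have h' : c⁻¹ * (c⁻¹ * ⟪v, S v⟫) ≤ c⁻¹ * ‖v‖ ^ 2 := by
    gcongr
    rwa [inv_mul_le_iff₀ hc]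
  rw [div_eq_inv_mul]
  linarith

variable {g : E → E} {B : E → E →L[ℝ] E} {M D : ℝ}

theorem hasDerivAt_inner_comp_add_smul (hg : ∀ y, HasFDerivAt g (B y) y) (x v : E) (t : ℝ) :
    HasDerivAt (fun s : ℝ => ⟪g (x + s • v), v⟫) ⟪B (x + t • v) v, v⟫ t := by
  have hline : HasDerivAt (fun s : ℝ => x + s • v) v t := by
    simpa using ((hasDerivAt_id t).smul_const v).const_add x
  simpa using ((hg _).comp_hasDerivAt t hline).inner ℝ (hasDerivAt_const t v)

theorem injective_of_hasFDerivAt_of_inner_pos (hg : ∀ y, HasFDerivAt g (B y) y)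
    (hpos : ∀ y v, v ≠ 0 → 0 < ⟪B y v, v⟫) : Function.Injective g := by
  intro x y hxy
  by_contra hne
  have hmono : StrictMono fun s : ℝ => ⟪g (x + s • (y - x)), y - x⟫ :=
    strictMono_of_deriv_pos fun t => by
      rw [(hasDerivAt_inner_comp_add_smul hg x (y - x) t).deriv]
      exact hpos _ _ (sub_ne_zero.2 (Ne.symm hne))
  simpa [hxy] using hmono (zero_lt_one (α := ℝ))

theorem log_le_mul_norm_sub_of_inner_lower_bound (hg : ∀ y, HasFDerivAt g (B y) y) (hM : 0 < M)
    (hD : 0 < D) (hB : ∀ y v, ‖v‖ ^ 2 / (M + D * ‖y‖) ≤ ⟪B y v, v⟫) (y : E) :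
    Real.log (M + D * ‖y‖) - Real.log M ≤ D * ‖g y - g 0‖ := by
  rcases eq_or_ne y 0 with rfl | hy
  · simp
  have hy' : 0 < ‖y‖ := norm_pos_iff.2 hy
  let f : ℝ → ℝ := fun s =>
    D * ⟪g (0 + s • y), y⟫ - ‖y‖ * Real.log (M + D * (s * ‖y‖))
  have hf : ∀ t, 0 ≤ t → HasDerivAt f
      (D * ⟪B (0 + t • y) y, y⟫ - ‖y‖ * ((D * ‖y‖) / (M + D * (t * ‖y‖)))) t := by
    intro t ht
    have hne : M + D * (t * ‖y‖) ≠ 0 := by positivity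
    have hlin : HasDerivAt (fun s : ℝ => M + D * (s * ‖y‖)) (D * ‖y‖) t := by
      simpa using (((hasDerivAt_id t).mul_const ‖y‖).const_mul D).const_add M
    exact ((hasDerivAt_inner_comp_add_smul hg 0 y t).const_mul D).sub
      ((hlin.log hne).const_mul ‖y‖)
  have hmono : MonotoneOn f (Set.Icc 0 1) := by
    refine monotoneOn_of_deriv_nonneg (convex_Icc 0 1)
      (fun t ht => (hf t ht.1).continuousAt.continuousWithinAt) ?_ ?_
    · rw [interior_Icc]
      exact fun t ht => (hf t ht.1.le).differentiableAt.differentiableWithinAt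
    · rw [interior_Icc]
      intro t ht
      rw [(hf t ht.1.le).deriv]
      have h := mul_le_mul_of_nonneg_left (hB (0 + t • y) y) hD.le
      rw [zero_add, norm_smul, Real.norm_of_nonneg ht.1.le] at h
      rw [zero_add, sub_nonneg]
      refine le_of_eq_of_le ?_ h
      ring
  have h01 : f 0 ≤ f 1 := hmono (by simp) (by simp) zero_le_one
  simp only [f, zero_smul, zero_add, zero_mul, mul_zero, add_zero, one_smul, one_mul] at h01
  have hinner : ⟪g y, y⟫ - ⟪g 0, y⟫ ≤ ‖g y - g 0‖ * ‖y‖ := by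
    rw [← inner_sub_left]
    exact real_inner_le_norm _ _
  refine le_of_mul_le_mul_left ?_ hy'
  have := mul_le_mul_of_nonneg_left hinner hD.le
  linarith

variable [FiniteDimensional ℝ E]

theorem surjective_of_hasStrictFDerivAt_equiv_of_tendsto_norm {g' : E → E ≃L[ℝ] E}
    (hg : ∀ y, HasStrictFDerivAt g (g' y : E →L[ℝ] E) y)
    (hlim : Filter.Tendsto (fun y => ‖g y‖) (Filter.cocompact E) Filter.atTop) :
    Function.Surjective g := by
  have hcont : Continuous g :=
    continuous_iff_continuousAt.2 fun y => (hg y).hasFDerivAt.continuousAt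
  have hproper : IsProperMap g := by
    refine isProperMap_iff_tendsto_cocompact.2 ⟨hcont, ?_⟩
    rw [← Metric.cobounded_eq_cocompact, ← comap_norm_atTop, Filter.tendsto_comap_iff]
    rwa [comap_norm_atTop, Metric.cobounded_eq_cocompact]
  have hclopen : IsClopen (Set.range g) :=
    ⟨hproper.isClosedMap.isClosed_range,
      (isOpenMap_of_hasStrictFDerivAt_equiv hg).isOpen_range⟩
  exact Set.range_eq_univ.1 (hclopen.eq_univ (Set.range_nonempty g))

theorem bijective_of_inner_fderiv_lower_bound (hg : ∀ y, HasFDerivAt g (B y) y)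
    (hBc : Continuous B) (hM : 0 < M) (hD : 0 < D)
    (hB : ∀ y v, ‖v‖ ^ 2 / (M + D * ‖y‖) ≤ ⟪B y v, v⟫) : Function.Bijective g := by
  have hpos : ∀ y v, v ≠ 0 → 0 < ⟪B y v, v⟫ := fun y v hv =>
    lt_of_lt_of_le (by have := norm_pos_iff.2 hv; positivity) (hB y v)
  have hinj : ∀ y, Function.Injective (B y : E →ₗ[ℝ] E) := by
    intro y
    refine (injective_iff_map_eq_zero (B y)).2 fun v hv => ?_
    by_contra hne
    simpa [hv] using hpos y v hne
  refine ⟨injective_of_hasFDerivAt_of_inner_pos hg hpos,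
    surjective_of_hasStrictFDerivAt_equiv_of_tendsto_norm
      (g' := fun y =>
        (LinearEquiv.ofInjectiveEndo (B y : E →ₗ[ℝ] E) (hinj y)).toContinuousLinearEquiv) ?_ ?_⟩
  · intro y
    exact hasStrictFDerivAt_of_hasFDerivAt_of_continuousAt
      (Filter.Eventually.of_forall hg) hBc.continuousAt
  · have hlog : Filter.Tendsto
        (fun y : E => D⁻¹ * (Real.log (M + D * ‖y‖) - Real.log M) - ‖g 0‖)
        (Filter.cocompact E) Filter.atTop := by
      refine Filter.tendsto_atTop_add_const_right _ _ (Filter.Tendsto.const_mul_atTop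
        (inv_pos.2 hD) (Filter.tendsto_atTop_add_const_right _ _ (Real.tendsto_log_atTop.comp
          (Filter.tendsto_atTop_add_const_left _ _ (Filter.Tendsto.const_mul_atTop hD ?_)))))
      exact tendsto_norm_cocompact_atTop
    refine Filter.tendsto_atTop_mono (fun y => ?_) hlog
    have h := log_le_mul_norm_sub_of_inner_lower_bound hg hM hD hB y
    rw [← inv_mul_le_iff₀ hD] at h
    linarith [norm_sub_le (g y) (g 0)]

end Bijectivity

theorem exists_hasFDerivAt_ringInverse_of_symmetric {E : Type*} [NormedAddCommGroup E]
    [NormedSpace ℝ E] [CompleteSpace E] {L : E → E →L[ℝ] E} (hL : Differentiable ℝ L)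
    (hunit : ∀ y, IsUnit (L y))
    (hsymm : ∀ y u w, fderiv ℝ L y u (Ring.inverse (L y) w)
      = fderiv ℝ L y w (Ring.inverse (L y) u)) :
    ∃ g : E → E, ∀ y, HasFDerivAt g (Ring.inverse (L y)) y := by
  have hder : ∀ y u w, fderiv ℝ (fun y => Ring.inverse (L y)) y u w
      = -Ring.inverse (L y) (fderiv ℝ L y u (Ring.inverse (L y) w)) := by
    intro y u w
    obtain ⟨a, ha⟩ := hunit y
    have h := hasFDerivAt_ringInverse (𝕜 := ℝ) a
    rw [ha] at h
    have hcomp : HasFDerivAt (fun y => Ring.inverse (L y)) _ y := h.comp y (hL y).hasFDerivAt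
    rw [hcomp.fderiv, ← ha, Ring.inverse_unit]
    simp
  obtain ⟨g, hg⟩ := convex_univ.exists_forall_hasFDerivAt_of_fderiv_symmetric isOpen_univ
    (ω := fun y => Ring.inverse (L y))
    (fun y _ => ((differentiableAt_inverse (hunit y)).comp y (hL y)).differentiableWithinAt)
    (fun y _ u w => by rw [hder, hder, hsymm])
  exact ⟨g, fun y => hg y (Set.mem_univ y)⟩

section MatrixField

variable {d : ℕ} {σ : EuclideanSpace ℝ (Fin d) → Matrix (Fin d) (Fin d) ℝ}

theorem contDiff_toEuclideanCLM {n : WithTop ℕ∞} (hσ : ∀ i j, ContDiff ℝ n fun y => σ y i j) :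
    ContDiff ℝ n fun y => Matrix.toEuclideanCLM (𝕜 := ℝ) (σ y) := by
  refine contDiff_clm_apply_iff.2 fun v => contDiff_euclidean.2 fun i => ?_
  simp only [Matrix.ofLp_toEuclideanCLM, Matrix.mulVec, dotProduct]
  exact ContDiff.sum fun j _ => (hσ i j).mul contDiff_const

theorem fderiv_toEuclideanCLM_single (hσ : ∀ i j, Differentiable ℝ fun y => σ y i j)
    (hL : Differentiable ℝ fun y => Matrix.toEuclideanCLM (𝕜 := ℝ) (σ y))
    (y : EuclideanSpace ℝ (Fin d)) (k : Fin d) :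
    fderiv ℝ (fun y => Matrix.toEuclideanCLM (𝕜 := ℝ) (σ y)) y (EuclideanSpace.single k 1)
      = Matrix.toEuclideanCLM (𝕜 := ℝ) (matPartialDeriv σ y k) := by
  ext v i
  have h₁ : HasFDerivAt (fun z => (Matrix.toEuclideanCLM (𝕜 := ℝ) (σ z) v) i)
      ((EuclideanSpace.proj (𝕜 := ℝ) i).comp
        ((ContinuousLinearMap.apply ℝ (EuclideanSpace ℝ (Fin d)) v).comp
          (fderiv ℝ (fun y => Matrix.toEuclideanCLM (𝕜 := ℝ) (σ y)) y))) y :=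
    (EuclideanSpace.proj (𝕜 := ℝ) i).hasFDerivAt.comp y
      ((ContinuousLinearMap.apply ℝ (EuclideanSpace ℝ (Fin d)) v).hasFDerivAt.comp y
        (hL y).hasFDerivAt)
  have h₂ : HasFDerivAt (fun z => (Matrix.toEuclideanCLM (𝕜 := ℝ) (σ z) v) i)
      (∑ j, v j • fderiv ℝ (fun z => σ z i j) y) y := by
    simp only [Matrix.ofLp_toEuclideanCLM, Matrix.mulVec, dotProduct]
    exact HasFDerivAt.fun_sum fun j _ => (hσ i j y).hasFDerivAt.mul_const (v j)
  have h := DFunLike.congr_fun (h₁.unique h₂) (EuclideanSpace.single k 1)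
  simp only [ContinuousLinearMap.comp_apply, ContinuousLinearMap.apply_apply,
    _root_.sum_apply, _root_.smul_apply, smul_eq_mul] at h
  refine h.trans ?_
  simp [Matrix.mulVec, dotProduct, matPartialDeriv, mul_comm]

theorem ringInverse_toEuclideanCLM {A : Matrix (Fin d) (Fin d) ℝ} (hA : IsUnit A) :
    Ring.inverse (Matrix.toEuclideanCLM (𝕜 := ℝ) A) = Matrix.toEuclideanCLM (𝕜 := ℝ) A⁻¹ := by
  rw [Matrix.nonsing_inv_eq_ringInverse]
  obtain ⟨a, rfl⟩ := hA
  rw [Ring.inverse_unit]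
  exact Ring.inverse_unit (Units.map
    (MonoidHomClass.toMonoidHom (Matrix.toEuclideanCLM (n := Fin d) (𝕜 := ℝ))) a)

theorem CurlCondition.fderiv_symmetric (hcurl : CurlCondition σ)
    (hσ : ∀ i j, Differentiable ℝ fun y => σ y i j)
    (hL : Differentiable ℝ fun y => Matrix.toEuclideanCLM (𝕜 := ℝ) (σ y))
    (y u w : EuclideanSpace ℝ (Fin d)) :
    fderiv ℝ (fun y => Matrix.toEuclideanCLM (𝕜 := ℝ) (σ y)) y u
        (Matrix.toEuclideanCLM (𝕜 := ℝ) (σ y)⁻¹ w)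
      = fderiv ℝ (fun y => Matrix.toEuclideanCLM (𝕜 := ℝ) (σ y)) y w
        (Matrix.toEuclideanCLM (𝕜 := ℝ) (σ y)⁻¹ u) := by
  set F := fderiv ℝ (fun y => Matrix.toEuclideanCLM (𝕜 := ℝ) (σ y)) y with hF
  have hbasis : ∀ j k, F (EuclideanSpace.single k 1)
        (Matrix.toEuclideanCLM (𝕜 := ℝ) (σ y)⁻¹ (EuclideanSpace.single j 1))
      = F (EuclideanSpace.single j 1)
        (Matrix.toEuclideanCLM (𝕜 := ℝ) (σ y)⁻¹ (EuclideanSpace.single k 1)) := by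
    intro j k
    rw [hF, fderiv_toEuclideanCLM_single hσ hL, fderiv_toEuclideanCLM_single hσ hL]
    apply WithLp.ofLp_injective
    simpa only [Matrix.ofLp_toEuclideanCLM, Matrix.mulVec_mulVec, PiLp.ofLp_single] using hcurl y j k
  have hsum (v : EuclideanSpace ℝ (Fin d)) : v = ∑ j, v j • EuclideanSpace.single j (1 : ℝ) := by
    simpa using ((EuclideanSpace.basisFun (Fin d) ℝ).sum_repr v).symm
  rw [hsum u, hsum w]
  simp only [map_sum, map_smul, _root_.sum_apply, _root_.smul_apply, Finset.smul_sum]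
  rw [Finset.sum_comm]
  refine Finset.sum_congr rfl fun j _ => Finset.sum_congr rfl fun k _ => ?_
  rw [hbasis, smul_comm]

end MatrixField

/-- analytic core of Theorems 1 and 4: existence of a globally
invertible Lamperti transform: if `σ : ℝ^d → ℝ^{d×d}` is continuously differentiable,
`σ(y)` is symmetric positive definite for every `y`, `σ` is globally Lipschitz in the
operator norm, and `σ` satisfies the curl condition, then there exists a bijective,
continuously differentiable map `g : ℝ^d → ℝ^d` with Jacobian `Dg(y) = σ(y)⁻¹`
for every `y`. -/
theorem exists_global_lamperti_transform (d : ℕ) (hd : 1 ≤ d)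
    (σ : EuclideanSpace ℝ (Fin d) → Matrix (Fin d) (Fin d) ℝ)
    (hσ_c1 : ∀ i j, ContDiff ℝ 1 fun y => σ y i j)
    (hσ_pd : ∀ y, (σ y).PosDef)
    (D : ℝ) (hD : 0 < D)
    (hLip : ∀ x y : EuclideanSpace ℝ (Fin d),
      ‖Matrix.toEuclideanCLM (𝕜 := ℝ) (σ x - σ y)‖ ≤ D * ‖x - y‖)
    (hcurl : CurlCondition σ) :
    ∃ g : EuclideanSpace ℝ (Fin d) → EuclideanSpace ℝ (Fin d),
      Function.Bijective g ∧
      ContDiff ℝ 1 g ∧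
      ∀ y i j, fderiv ℝ (fun y => g y i) y (EuclideanSpace.single j 1) = (σ y)⁻¹ i j := by
  have hunit y : IsUnit (σ y) := (hσ_pd y).isUnit
  have hLunit y : IsUnit (Matrix.toEuclideanCLM (𝕜 := ℝ) (σ y)) :=
    (hunit y).map (Matrix.toEuclideanCLM (n := Fin d) (𝕜 := ℝ))
  have hσ_diff i j : Differentiable ℝ fun y => σ y i j := (hσ_c1 i j).differentiable one_ne_zero
  have hL : ContDiff ℝ 1 fun y => Matrix.toEuclideanCLM (𝕜 := ℝ) (σ y) :=
    contDiff_toEuclideanCLM hσ_c1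
  have hL_diff := hL.differentiable one_ne_zero
  have hBc : Continuous fun y => Matrix.toEuclideanCLM (𝕜 := ℝ) (σ y)⁻¹ := by
    simp only [← ringInverse_toEuclideanCLM (hunit _)]
    exact continuous_iff_continuousAt.2 fun y =>
      ((differentiableAt_inverse (𝕜 := ℝ) (hLunit y)).fun_comp' y (hL_diff y)).continuousAt
  obtain ⟨g, hg⟩ := exists_hasFDerivAt_ringInverse_of_symmetric hL_diff hLunit
    fun y u w => by
      simpa only [ringInverse_toEuclideanCLM (hunit y)] using
        hcurl.fderiv_symmetric hσ_diff hL_diff y u w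
  simp only [ringInverse_toEuclideanCLM (hunit _)] at hg
  refine ⟨g, ?_, contDiff_one_iff_hasFDerivAt.2 ⟨_, hBc, hg⟩, fun y i j => ?_⟩
  · refine bijective_of_inner_fderiv_lower_bound
      (M := ‖Matrix.toEuclideanCLM (𝕜 := ℝ) (σ 0)‖ + 1) hg hBc (by positivity) hD fun y v => ?_
    have hinv := (hσ_pd y).inv
    refine ContinuousLinearMap.sq_norm_div_le_inner_of_mul_eq_one
      (S := Matrix.toEuclideanCLM (𝕜 := ℝ) (σ y)) ?_ ?_ ?_ (by positivity) ?_ v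
    · exact Matrix.isSymmetric_toEuclideanLin_iff.2 hinv.isHermitian
    · rw [← map_mul, Matrix.nonsing_inv_mul _ ((Matrix.isUnit_iff_isUnit_det _).1 (hunit y)),
        map_one]
    · intro w
      rw [real_inner_comm, Matrix.inner_toEuclideanCLM]
      simpa using hinv.posSemidef.dotProduct_mulVec_nonneg w.ofLp
    · have h := hLip y 0
      rw [map_sub, sub_zero] at h
      linarith [norm_le_norm_sub_add (Matrix.toEuclideanCLM (𝕜 := ℝ) (σ y))
        (Matrix.toEuclideanCLM (𝕜 := ℝ) (σ 0))]
  · have h : HasFDerivAt (fun z => g z i)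
        ((EuclideanSpace.proj (𝕜 := ℝ) i).comp (Matrix.toEuclideanCLM (𝕜 := ℝ) (σ y)⁻¹)) y :=
      (EuclideanSpace.proj (𝕜 := ℝ) i).hasFDerivAt.comp y (hg y)
    rw [h.fderiv]
    simp [Matrix.ofLp_toEuclideanCLM]
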